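/- arXiv:2504.12886 — 2 statements merged into one kernel-verified Lean document; each statement's English description precedes it below -/
import Mathlib

section
/- Let R be a finite local ring with identity, with |R| = q^n for some integer n ≥ 2, whose residue field R/J has q elements, where J = J(R) is the Jacobson radical. Then for x ∈ R, x is a unit if and only if P_x(R) = (q − 1)/q^{n+1}. -/
/-- The multiplication probability of a finite ring `R` at `x`:
`P_x(R) = |{(a,b) ∈ R × R : a*b = x}| / |R|²`. -/
noncomputable def mulProb (R : Type*) [Ring R] (x : R) : ℚ :=
  (Nat.card {p : R × R // p.1 * p.2 = x} : ℚ) / (Nat.card R : ℚ) ^ 2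

/-- The Jacobson radical of a ring, as a two-sided ideal. -/
abbrev jacobsonRadical (R : Type*) [Ring R] : TwoSidedIdeal R :=
  (⊥ : TwoSidedIdeal R).jacobson

/-- The residue ring `R/J(R)` of a ring modulo its Jacobson radical. -/
abbrev residueRing (R : Type*) [Ring R] : Type _ :=
  (jacobsonRadical R).ringCon.Quotient

theorem aux_unit_left {R : Type*} [Ring R] [Finite R] {a b : R} (h : IsUnit (a * b)) :
    IsUnit a ∧ IsUnit b := by
  have key : ∀ c d : R, c * d = 1 → d * c = 1 := by
    intro c d hcd
    have hinj : Function.Injective (fun y : R => d * y) := by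
      intro y z hyz
      have h2 : c * (d * y) = c * (d * z) := congrArg (c * ·) hyz
      rwa [← mul_assoc, ← mul_assoc, hcd, one_mul, one_mul] at h2
    obtain ⟨y, hy⟩ := Finite.surjective_of_injective hinj 1
    have hy' : d * y = 1 := hy
    have : c = y := by
      calc c = c * (d * y) := by rw [hy', mul_one]
        _ = y := by rw [← mul_assoc, hcd, one_mul]
    rw [this]; exact hy'
  obtain ⟨u, hu⟩ := h
  have h1 : a * (b * ↑u⁻¹) = 1 := by rw [← mul_assoc, ← hu, Units.mul_inv]
  have h2 : (↑u⁻¹ * a) * b = 1 := by rw [mul_assoc, ← hu, Units.inv_mul]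
  exact ⟨⟨⟨a, _, h1, key _ _ h1⟩, rfl⟩, ⟨⟨b, _, key _ _ h2, h2⟩, rfl⟩⟩

theorem aux_mem_jac {R : Type*} [Ring R] [Finite R] [IsLocalRing R] (x : R) :
    x ∈ jacobsonRadical R ↔ ¬ IsUnit x := by
  rw [jacobsonRadical, TwoSidedIdeal.mem_jacobson_iff]
  constructor
  · rintro h ⟨u, rfl⟩
    obtain ⟨z, hz⟩ := h (-↑u⁻¹)
    rw [TwoSidedIdeal.mem_bot] at hz
    simp at hz
  · intro hx y
    have h1 : ¬ IsUnit (-y * x) := fun h => hx (aux_unit_left h).2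
    have h2 : IsUnit (1 - (-y * x)) :=
      (IsLocalRing.isUnit_or_isUnit_of_add_one (add_sub_cancel (-y * x) 1)).resolve_left h1
    obtain ⟨u, hu⟩ := h2
    refine ⟨↑u⁻¹, ?_⟩
    rw [TwoSidedIdeal.mem_bot]
    have h3 : (↑u⁻¹ : R) * (1 - (-y * x)) = 1 := by rw [← hu, Units.inv_mul]
    rw [← h3]; noncomm_ring

theorem aux_card_res {R : Type*} [Ring R] [Finite R] [IsLocalRing R] :
    Nat.card R = Nat.card (residueRing R) * Nat.card {x : R // ¬ IsUnit x} := by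
  let f : R →+* residueRing R := (jacobsonRadical R).ringCon.mk'
  have hf : Function.Surjective f := RingCon.mk'_surjective _
  rw [AddSubgroup.card_eq_card_quotient_mul_card_addSubgroup f.toAddMonoidHom.ker,
    Nat.card_congr (QuotientAddGroup.quotientKerEquivOfSurjective f.toAddMonoidHom hf).toEquiv]
  congr 1
  refine Nat.card_congr (Equiv.subtypeEquivRight fun x => ?_)
  rw [← aux_mem_jac, AddMonoidHom.mem_ker]
  change ((x : R) : (jacobsonRadical R).ringCon.Quotient) = ((0 : R) : (jacobsonRadical R).ringCon.Quotient) ↔ _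
  rw [RingCon.eq, TwoSidedIdeal.rel_iff, sub_zero]

theorem aux_card_units {R : Type*} [Ring R] [Finite R] :
    Nat.card R = Nat.card Rˣ + Nat.card {x : R // ¬ IsUnit x} := by
  classical
  rw [← Nat.card_congr (Equiv.sumCompl (fun x : R => IsUnit x)), Nat.card_sum]
  congr 1
  symm
  refine Nat.card_congr (Equiv.ofBijective (fun u : Rˣ => ⟨(u : R), u.isUnit⟩) ⟨?_, ?_⟩)
  · intro u v h
    exact Units.ext (congrArg Subtype.val h)
  · rintro ⟨_, u, rfl⟩
    exact ⟨u, rfl⟩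

theorem aux_count_unit {R : Type*} [Ring R] [Finite R] {x : R} (hx : IsUnit x) :
    Nat.card {p : R × R // p.1 * p.2 = x} = Nat.card Rˣ := by
  symm
  refine Nat.card_congr (Equiv.ofBijective
    (fun u : Rˣ => ⟨((u : R), ↑u⁻¹ * x), by simp⟩) ⟨?_, ?_⟩)
  · intro u v h
    exact Units.ext (congrArg (fun s => s.1.1) h)
  · rintro ⟨⟨a, b⟩, h⟩
    change a * b = x at h
    subst h
    obtain ⟨u, rfl⟩ := (aux_unit_left hx).1
    exact ⟨u, by simp⟩

theorem aux_count_nonunit {R : Type*} [Ring R] [Finite R] {x : R} (hx : ¬ IsUnit x) :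
    Nat.card Rˣ < Nat.card {p : R × R // p.1 * p.2 = x} := by
  have hpos : 0 < Nat.card Rˣ := Nat.card_pos
  let g : Rˣ ⊕ Rˣ → {p : R × R // p.1 * p.2 = x} :=
    Sum.elim (fun u => ⟨((u : R), ↑u⁻¹ * x), by simp⟩) (fun u => ⟨(x * ↑u⁻¹, (u : R)), by simp⟩)
  have hg : Function.Injective g := by
    have h0 : ∀ u v : Rˣ, (u : R) ≠ x * ↑v⁻¹ := by
      intro u v h
      exact hx (aux_unit_left (h ▸ u.isUnit : IsUnit (x * ↑v⁻¹))).1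
    rintro (u | u) (v | v) h
    · exact congrArg Sum.inl (Units.ext (congrArg (fun s => s.1.1) h))
    · exact absurd (congrArg (fun s => s.1.1) h) (h0 u v)
    · exact absurd (congrArg (fun s => s.1.1) h).symm (h0 v u)
    · exact congrArg Sum.inr (Units.ext (congrArg (fun s => s.1.2) h))
  have := Nat.card_le_card_of_injective g hg
  rw [Nat.card_sum] at this
  omega


/-- Let `R` be a finite local ring with `|R| = qⁿ`, `n ≥ 2`, whose residue
field `R/J` has `q` elements. Then `x ∈ R` is a unit iff `P_x(R) = (q − 1)/q^{n+1}`. -/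
theorem isUnit_iff_mulProb_local
    {R : Type*} [Ring R] [Finite R] [IsLocalRing R] {q n : ℕ} (hn : 2 ≤ n)
    (hcard : Nat.card R = q ^ n) (hres : Nat.card (residueRing R) = q) (x : R) :
    IsUnit x ↔ mulProb R x = ((q : ℚ) - 1) / (q : ℚ) ^ (n + 1) := by
  have h1 := aux_card_res (R := R)
  have h2 := aux_card_units (R := R)
  have hRpos : 0 < Nat.card R := Nat.card_pos
  rw [hres] at h1
  have hq : q ≠ 0 := by
    rintro rfl
    rw [zero_mul] at h1
    omega
  have hq' : (q : ℚ) ≠ 0 := Nat.cast_ne_zero.mpr hq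
  have h1' : (q : ℚ) ^ n = q * (Nat.card {x : R // ¬ IsUnit x} : ℚ) := by
    rw [hcard] at h1
    exact_mod_cast h1
  have h2' : (q : ℚ) ^ n = Nat.card Rˣ + (Nat.card {x : R // ¬ IsUnit x} : ℚ) := by
    rw [hcard] at h2
    exact_mod_cast h2
  have hU : ((q : ℚ) - 1) / (q : ℚ) ^ (n + 1) = (Nat.card Rˣ : ℚ) / ((q : ℚ) ^ n) ^ 2 := by
    rw [div_eq_div_iff (by positivity) (by positivity), pow_succ]
    linear_combination ((q : ℚ) ^ n) * ((q : ℚ) * h2' - h1')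
  have hR : (Nat.card R : ℚ) = (q : ℚ) ^ n := by rw [hcard]; push_cast; rfl
  rw [hU, mulProb, hR, div_left_inj' (by positivity), Nat.cast_inj]
  constructor
  · exact aux_count_unit
  · intro h
    by_contra hx
    exact absurd h (aux_count_nonunit hx).ne'
end

section
/- Let R be a finite local ring with identity, with |R| = q^n, whose residue field R/J has q elements, where J = J(R) is the Jacobson radical, and suppose J^{n−1} ≠ 0. Then P_0(R) = ((n+1)q − n)/q^{n+1}. -/
open Pointwise in
/-- Powers of a two-sided ideal, as additive submonoids of `R`: `J⁰ = R`, `J¹ = J`, and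
`J^(k+1) = J · J^k` (the product ideal). -/
def idealPow {R : Type*} [Ring R] (J : TwoSidedIdeal R) : ℕ → AddSubmonoid R
  | 0 => ⊤
  | 1 => J.asIdeal.toAddSubmonoid
  | (k + 2) => J.asIdeal.toAddSubmonoid * idealPow J (k + 1)

lemma aux_card {R : Type*} [Ring R] [Finite R] (K N J : AddSubgroup R) (f : R →+ R) (q : ℕ)
    (hK : K ≤ N) (hf : ∀ r, f r ∈ N) (hJ : ∀ r, f r ∈ K ↔ r ∈ J)
    (hc : Nat.card R = q * Nat.card J) :
    q * Nat.card K ≤ Nat.card N ∧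
      (q * Nat.card K = Nat.card N → ∀ x ∈ N, ∃ r, x - f r ∈ K) := by
  let g : R × K →+ R := f.coprod K.subtype
  have hg : ∀ p, g p = f p.1 + p.2 := fun p => rfl
  have hker : Nat.card g.ker = Nat.card J := by
    refine Nat.card_congr
      { toFun := fun p => ⟨p.1.1, ?_⟩
        invFun := fun r => ⟨(r.1, ⟨-f r.1, K.neg_mem ((hJ _).2 r.2)⟩), ?_⟩
        left_inv := ?_
        right_inv := ?_ }
    · have h := p.2
      rw [AddMonoidHom.mem_ker, hg] at h
      rw [← hJ, eq_neg_of_add_eq_zero_left h]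
      exact K.neg_mem p.1.2.2
    · rw [AddMonoidHom.mem_ker, hg]; simp
    · rintro ⟨⟨r, x⟩, h⟩
      rw [AddMonoidHom.mem_ker, hg] at h
      ext
      · rfl
      · simp only; exact (eq_neg_of_add_eq_zero_right h).symm
    · intro r; rfl
  have hle : g.range ≤ N := by
    rintro _ ⟨p, rfl⟩
    rw [hg]; exact N.add_mem (hf _) (hK p.2.2)
  have h1 : Nat.card (R × K) = Nat.card g.range * Nat.card g.ker := by
    rw [AddSubgroup.card_eq_card_quotient_mul_card_addSubgroup g.ker,
      Nat.card_congr (QuotientAddGroup.quotientKerEquivRange g).toEquiv]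
  have hJpos : 0 < Nat.card J := Nat.card_pos
  have h2 : q * Nat.card K = Nat.card g.range := by
    rw [Nat.card_prod, hker, hc] at h1
    apply Nat.eq_of_mul_eq_mul_right hJpos
    rw [← h1]; ring
  constructor
  · rw [h2]; exact Nat.card_le_card_of_injective _ (AddSubgroup.inclusion_injective hle)
  · intro h x hx
    rw [h2] at h
    have := AddSubgroup.eq_of_le_of_card_ge hle h.ge
    rw [← this] at hx
    obtain ⟨p, rfl⟩ := hx
    refine ⟨p.1, ?_⟩
    rw [hg]; simp

/-- Right multiplication by an element just outside. -/
lemma aux_left {R : Type*} [Ring R] [Finite R] (J : Ideal R) [J.IsTwoSided] (q : ℕ)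
    (hu : ∀ r, r ∉ J → IsUnit r)
    (hc : Nat.card R = q * Nat.card J) (k : ℕ) (a : R) (ha : a ∈ J ^ k) (ha' : a ∉ J ^ (k + 1)) :
    q * Nat.card ↥(J ^ (k + 1)) ≤ Nat.card ↥(J ^ k) ∧
      (q * Nat.card ↥(J ^ (k + 1)) = Nat.card ↥(J ^ k) → ∀ x ∈ J ^ k,
        ∃ r, x - r * a ∈ J ^ (k + 1)) := by
  refine aux_card (J ^ (k+1)).toAddSubgroup (J ^ k).toAddSubgroup J.toAddSubgroup
    (AddMonoidHom.mulRight a) q ?_ ?_ ?_ hc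
  · exact fun x hx => Ideal.pow_le_pow_right (Nat.le_succ k) hx
  · exact fun r => (J ^ k).mul_mem_left r ha
  · intro r
    change r * a ∈ J ^ (k+1) ↔ r ∈ J
    constructor
    · intro h
      by_contra hr
      obtain ⟨u, rfl⟩ := hu r hr
      apply ha'
      simpa using (J ^ (k+1)).mul_mem_left (↑u⁻¹ : R) h
    · intro h
      rw [Ideal.IsTwoSided.pow_succ]
      exact Ideal.mul_mem_mul h ha

lemma aux_right {R : Type*} [Ring R] [Finite R] (J : Ideal R) [J.IsTwoSided] (q : ℕ)
    (hu : ∀ r, r ∉ J → IsUnit r)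
    (hc : Nat.card R = q * Nat.card J) (k : ℕ) (a : R) (ha : a ∈ J ^ k) (ha' : a ∉ J ^ (k + 1)) :
    q * Nat.card ↥(J ^ (k + 1)) ≤ Nat.card ↥(J ^ k) ∧
      (q * Nat.card ↥(J ^ (k + 1)) = Nat.card ↥(J ^ k) → ∀ x ∈ J ^ k,
        ∃ r, x - a * r ∈ J ^ (k + 1)) := by
  refine aux_card (J ^ (k+1)).toAddSubgroup (J ^ k).toAddSubgroup J.toAddSubgroup
    (AddMonoidHom.mulLeft a) q ?_ ?_ ?_ hc
  · exact fun x hx => Ideal.pow_le_pow_right (Nat.le_succ k) hx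
  · exact fun r => (J ^ k).mul_mem_right r ha
  · intro r
    change a * r ∈ J ^ (k+1) ↔ r ∈ J
    constructor
    · intro h
      by_contra hr
      obtain ⟨u, rfl⟩ := hu r hr
      apply ha'
      simpa [mul_assoc] using (J ^ (k+1)).mul_mem_right (↑u⁻¹ : R) h
    · intro h
      rw [Ideal.IsTwoSided.pow_add, Submodule.pow_one]
      exact Ideal.mul_mem_mul ha h

lemma aux_strict {R : Type*} [Ring R] (J : Ideal R) [J.IsTwoSided] (hnil : ∃ m, J ^ m = ⊥)
    (k : ℕ) (h : J ^ k ≤ J ^ (k + 1)) : J ^ k = ⊥ := by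
  obtain ⟨m, hm⟩ := hnil
  have : ∀ j, J ^ k ≤ J ^ (k + j) := by
    intro j
    induction j with
    | zero => exact le_rfl
    | succ j ih =>
      refine ih.trans ?_
      rw [show k + (j + 1) = j + (k + 1) by omega, add_comm k j, Ideal.IsTwoSided.pow_add, Ideal.IsTwoSided.pow_add j (k+1)]
      exact Ideal.mul_mono le_rfl h
  have h2 := this m
  rw [eq_bot_iff]
  refine h2.trans ?_
  rw [← hm]
  exact Ideal.pow_le_pow_right (by omega)

lemma aux_main {R : Type*} [Ring R] [Finite R] (J : Ideal R) [J.IsTwoSided] (q n : ℕ)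
    (hq : 1 < q) (hn : 1 ≤ n)
    (hu : ∀ r, r ∉ J → IsUnit r) (hnil : ∃ m, J ^ m = ⊥)
    (hc : Nat.card R = q * Nat.card J) (hcard : Nat.card R = q ^ n) (hJ : J ^ (n - 1) ≠ ⊥) :
    Nat.card {p : R × R // p.1 * p.2 = 0} + n * q ^ (n - 1) = (n + 1) * q ^ n := by
  have hq0 : 0 < q := by omega
  have hstrict : ∀ k < n, ¬ J ^ k ≤ J ^ (k + 1) := by
    intro k hk h
    have := aux_strict J hnil k h
    apply hJ
    rw [eq_bot_iff, ← this]
    exact Ideal.pow_le_pow_right (by omega)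
  have hex : ∀ k < n, ∃ a ∈ J ^ k, a ∉ J ^ (k + 1) := by
    intro k hk
    simpa [SetLike.le_def] using hstrict k hk
  have hstep : ∀ k < n, q * Nat.card ↥(J ^ (k + 1)) ≤ Nat.card ↥(J ^ k) := by
    intro k hk
    obtain ⟨a, ha, ha'⟩ := hex k hk
    exact (aux_left J q hu hc k a ha ha').1
  have hup : ∀ k ≤ n, q ^ k * Nat.card ↥(J ^ k) ≤ q ^ n := by
    intro k
    induction k with
    | zero =>
      intro _
      rw [pow_zero, one_mul, ← hcard]
      exact Nat.card_le_card_of_injective _ Subtype.val_injective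
    | succ k ih =>
      intro hk
      refine le_trans ?_ (ih (by omega))
      rw [pow_succ, mul_assoc]
      exact Nat.mul_le_mul_left _ (hstep k (by omega))
  have hdown : ∀ j ≤ n, q ^ j ≤ Nat.card ↥(J ^ (n - j)) := by
    intro j
    induction j with
    | zero => intro _; rw [pow_zero]; exact Nat.card_pos
    | succ j ih =>
      intro hj
      have h := hstep (n - (j+1)) (by omega)
      rw [show n - (j+1) + 1 = n - j by omega] at h
      refine le_trans ?_ h
      rw [pow_succ']
      exact Nat.mul_le_mul_left _ (ih (by omega))
  have hck : ∀ k ≤ n, Nat.card ↥(J ^ k) = q ^ (n - k) := by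
    intro k hk
    apply le_antisymm
    · have h := hup k hk
      rw [show n = k + (n - k) by omega, pow_add] at h
      have := Nat.le_of_mul_le_mul_left h (by positivity)
      simpa using this
    · have := hdown (n - k) (by omega)
      rwa [show n - (n - k) = k by omega] at this
  have hceq : ∀ k < n, q * Nat.card ↥(J ^ (k + 1)) = Nat.card ↥(J ^ k) := by
    intro k hk
    rw [hck _ hk, hck _ hk.le, ← pow_succ', show n - (k+1) + 1 = n - k by omega]
  have hbot : J ^ n = ⊥ := by
    have h := hck n le_rfl
    rw [Nat.sub_self, pow_zero] at h
    have := (Nat.card_eq_one_iff_unique.1 h).1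
    exact (Submodule.eq_bot_iff _).2 fun x hx =>
      congrArg Subtype.val (Subsingleton.elim (⟨x, hx⟩ : ↥(J ^ n)) 0)
  have hprod : ∀ i k a b, i + k < n → a ∈ J ^ i → a ∉ J ^ (i + 1) → b ∈ J ^ k →
      b ∉ J ^ (k + 1) → a * b ≠ 0 := by
    intro i k a b hik ha ha' hb hb' hab
    apply hstrict (i + k) hik
    rw [Ideal.IsTwoSided.pow_add, Ideal.mul_le]
    intro x hx y hy
    obtain ⟨r, hr⟩ := (aux_left J q hu hc i a ha ha').2 (hceq i (by omega)) x hx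
    obtain ⟨s, hs⟩ := (aux_right J q hu hc k b hb hb').2 (hceq k (by omega)) y hy
    have h1 : (x - r * a) * y ∈ J ^ (i + k + 1) := by
      rw [show i + k + 1 = (i + 1) + k by omega, Ideal.IsTwoSided.pow_add]
      exact Ideal.mul_mem_mul hr hy
    have h2 : r * (a * (y - b * s)) ∈ J ^ (i + k + 1) := by
      apply Ideal.mul_mem_left
      rw [show i + k + 1 = i + (k + 1) by omega, Ideal.IsTwoSided.pow_add]
      exact Ideal.mul_mem_mul ha hs
    have h3 : x * y = (x - r * a) * y + r * (a * (y - b * s)) := by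
      have : r * (a * (y - b * s)) = r * a * y - r * (a * b) * s := by noncomm_ring
      rw [this, hab]; noncomm_ring
    rw [h3]; exact add_mem h1 h2
  have hann : ∀ i a, i < n → a ∈ J ^ i → a ∉ J ^ (i + 1) → ∀ b, a * b = 0 ↔ b ∈ J ^ (n - i) := by
    intro i a hi ha ha' b
    constructor
    · intro hab
      have : ∀ k ≤ n - i, b ∈ J ^ k := by
        intro k
        induction k with
        | zero => intro _; rw [Submodule.pow_zero, Ideal.one_eq_top]; trivial
        | succ k ih =>
          intro hk
          by_contra hb'
          exact hprod i k a b (by omega) ha ha' (ih (by omega)) hb' hab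
      exact this _ le_rfl
    · intro hb
      have : a * b ∈ J ^ n := by
        rw [show n = i + (n - i) by omega, Ideal.IsTwoSided.pow_add]
        exact Ideal.mul_mem_mul ha hb
      rw [hbot] at this
      exact this
  classical
  have := Fintype.ofFinite R
  let c : R → ℕ := fun a => Nat.card {b : R // a * b = 0}
  have htot : Nat.card {p : R × R // p.1 * p.2 = 0} = ∑ a, c a := by
    rw [Nat.card_congr (Equiv.subtypeProdEquivSigmaSubtype (fun a b : R => a * b = 0)),
      Nat.card_sigma]
  have hc1 : ∀ i a, i < n → a ∈ J ^ i → a ∉ J ^ (i + 1) → c a = q ^ i := by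
    intro i a hi ha ha'
    have h : c a = Nat.card ↥(J ^ (n - i)) :=
      Nat.card_congr (Equiv.subtypeEquivRight (hann i a hi ha ha'))
    rw [h, hck _ (by omega), show n - (n - i) = i by omega]
  let F : ℕ → Finset R := fun k => Finset.univ.filter (· ∈ J ^ k)
  have hF : ∀ k ≤ n, (F k).card = q ^ (n - k) := by
    intro k hk
    rw [← hck k hk, Nat.card_eq_fintype_card]
    exact (Fintype.card_subtype _).symm
  have hS : ∀ j ≤ n, (∑ a ∈ F (n - j), c a) + j * q ^ (n - 1) = (j + 1) * q ^ n := by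
    intro j
    induction j with
    | zero =>
      intro _
      have hF0 : F n = {0} := by
        ext x; simp [F, hbot]
      have : c 0 = q ^ n := by
        rw [← hcard]
        exact Nat.card_congr (Equiv.subtypeUnivEquiv (fun b => zero_mul b))
      simp [hF0, this]
    | succ j ih =>
      intro hj
      have ih := ih (by omega)
      set i := n - (j + 1) with hi
      have hij : n - j = i + 1 := by omega
      rw [hij] at ih
      have hsub : F (i + 1) ⊆ F i := by
        intro x hx
        simp only [F, Finset.mem_filter, Finset.mem_univ, true_and] at hx ⊢
        exact Ideal.pow_le_pow_right (Nat.le_succ i) hx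
      have hsd : ∑ a ∈ F i \ F (i + 1), c a = (F i \ F (i + 1)).card * q ^ i := by
        apply Finset.sum_const_nat
        intro x hx
        simp only [F, Finset.mem_sdiff, Finset.mem_filter, Finset.mem_univ, true_and] at hx
        exact hc1 i x (by omega) hx.1 hx.2
      have hcd : (F i \ F (i + 1)).card + q ^ (n - (i + 1)) = q ^ (n - i) := by
        rw [← hF i (by omega), ← hF (i+1) (by omega)]
        exact Finset.card_sdiff_add_card_eq_card hsub
      rw [← Finset.sum_sdiff hsub, hsd]
      have e : (F i \ F (i + 1)).card * q ^ i + q ^ (n - 1) = q ^ n := by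
        have := congrArg (· * q ^ i) hcd
        simp only [add_mul, ← pow_add] at this
        rwa [show n - (i + 1) + i = n - 1 by omega, show n - i + i = n by omega] at this
      linarith
  have h := hS n le_rfl
  have hF0 : F (n - n) = Finset.univ := by
    ext x; simp [F, Submodule.pow_zero, Ideal.one_eq_top]
  rw [hF0, ← htot] at h
  exact h

lemma aux_idealPow {R : Type*} [Ring R] (J : TwoSidedIdeal R) (k : ℕ) :
    idealPow J k = (J.asIdeal ^ k).toAddSubmonoid := by
  induction k with
  | zero => rw [idealPow, Submodule.pow_zero, Ideal.one_eq_top]; rfl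
  | succ k ih =>
    cases k with
    | zero => rw [idealPow, zero_add, Submodule.pow_one]
    | succ k =>
      rw [idealPow, ih, Ideal.IsTwoSided.pow_succ (k + 1)]
      rfl

/-- Let `R` be a finite local ring with `|R| = qⁿ`, whose residue field
`R/J` has `q` elements, and suppose `J^{n−1} ≠ 0`. Then `P_0(R) = ((n+1)q − n)/q^{n+1}`. -/
theorem mulProb_zero_of_chain
    {R : Type*} [Ring R] [Finite R] [IsLocalRing R] {q n : ℕ}
    (hcard : Nat.card R = q ^ n) (hres : Nat.card (residueRing R) = q)
    (hJ : idealPow (jacobsonRadical R) (n - 1) ≠ ⊥) :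
    mulProb R 0 = (((n : ℚ) + 1) * (q : ℚ) - (n : ℚ)) / (q : ℚ) ^ (n + 1) := by
  have hR : 1 < Nat.card R := Finite.one_lt_card
  have hn : 1 ≤ n := by
    rcases Nat.eq_zero_or_pos n with rfl | h
    · simp [hcard] at hR
    · exact h
  have hq : 1 < q := by
    by_contra h
    have : q ^ n ≤ 1 := Nat.pow_le_one_iff (by omega) |>.2 (by omega)
    omega
  set J : Ideal R := (jacobsonRadical R).asIdeal with hJdef
  have hJj : J = Ideal.jacobson ⊥ := by
    rw [hJdef, TwoSidedIdeal.asIdeal_jacobson, TwoSidedIdeal.bot_asIdeal]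
  have hunit : ∀ x y : R, x * y = 1 → IsUnit x ∧ IsUnit y := by
    intro x y h
    have h' : y * x = 1 := mul_eq_one_symm h
    exact ⟨⟨⟨x, y, h, h'⟩, rfl⟩, ⟨⟨y, x, h', h⟩, rfl⟩⟩
  have hu : ∀ r, r ∉ J → IsUnit r := by
    intro r hr
    by_contra hnu
    apply hr
    rw [hJj, Ideal.mem_jacobson_iff]
    intro y
    have h1 : IsUnit (y * r + 1) ∨ IsUnit (-(y * r)) :=
      IsLocalRing.isUnit_or_isUnit_of_add_one (by abel)
    rcases h1 with ⟨u, hu⟩ | ⟨u, hu⟩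
    · refine ⟨↑u⁻¹, ?_⟩
      have : (↑u⁻¹ : R) * (y * r + 1) = 1 := by rw [← hu]; simp
      rw [mul_add, mul_one, ← mul_assoc] at this
      rw [this]; simp
    · exfalso
      apply hnu
      have : (-(↑u⁻¹ : R) * y) * r = 1 := by
        have : (-(↑u⁻¹ : R) * y) * r = ↑u⁻¹ * (-(y * r)) := by noncomm_ring
        rw [this, ← hu]; simp
      exact (hunit _ _ this).2
  have hnil : ∃ m, J ^ m = ⊥ := by
    rw [hJj]
    exact IsArtinianRing.isNilpotent_jacobson_bot
  have hc : Nat.card R = q * Nat.card J := by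
    have e : (R ⧸ J) ≃ residueRing R := by
      refine Quotient.congrRight ?_
      intro a b
      change QuotientAddGroup.leftRel _ a b ↔ (jacobsonRadical R).ringCon a b
      rw [TwoSidedIdeal.rel_iff, QuotientAddGroup.leftRel_apply, hJdef]
      change -a + b ∈ (jacobsonRadical R).asIdeal ↔ _
      rw [TwoSidedIdeal.mem_asIdeal, ← neg_mem_iff]
      rw [show -(-a + b) = a - b by abel]
    rw [← hres, ← Nat.card_congr e]
    exact AddSubgroup.card_eq_card_quotient_mul_card_addSubgroup J.toAddSubgroup
  have hJ' : J ^ (n - 1) ≠ ⊥ := by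
    intro h
    apply hJ
    rw [aux_idealPow, ← hJdef, h]
    rfl
  have hmain := aux_main J q n hq hn hu hnil hc hcard hJ'
  obtain ⟨m, rfl⟩ : ∃ m, n = m + 1 := ⟨n - 1, by omega⟩
  rw [mulProb, hcard]
  have hm : (Nat.card {p : R × R // p.1 * p.2 = 0} : ℚ) =
      ((m + 1 : ℕ) + 1) * q ^ (m + 1) - (m + 1 : ℕ) * q ^ m := by
    rw [Nat.add_sub_cancel] at hmain
    have := congrArg (Nat.cast : ℕ → ℚ) hmain
    push_cast at this ⊢
    linarith
  rw [hm]
  have hq0 : (q : ℚ) ≠ 0 := by positivity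
  push_cast
  field_simp
  ring
end
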